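/- A filter F on a set X belongs to ker(F_1^{△◊}) if and only if for every family of sequences (x_n^α)_{n∈ω} in X, indexed by α ∈ I, such that the infimum ⋀_{α∈I} of their tail filters meshes with F, there exists a countable subset J ⊆ I such that the infimum ⋀_{α∈J} of the corresponding tail filters meshes with F. -/

import Mathlib

open Filter Set

universe u

/-- Two filters mesh if all their members intersect, i.e. the filter generated by
pairwise intersections (which is `F ⊓ G` in Mathlib's order) is proper. -/
def Mesh {Z : Type u} (F G : Filter Z) : Prop := Filter.NeBot (F ⊓ G)

/-- The `△` relation: `F △ H` iff whenever `H` meshes `F` there is a proper countably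
based filter refining `F ∨ H` (i.e. `≤ F ⊓ H` in Mathlib's order). -/
def Triangle {Z : Type u} (F H : Filter Z) : Prop :=
  Mesh H F → ∃ L : Filter Z, L.NeBot ∧ L.IsCountablyGenerated ∧ L ≤ F ⊓ H

/-- Fréchet filters: `F △ A` for every subset `A`. -/
def Frechet {Z : Type u} (F : Filter Z) : Prop := ∀ A : Set Z, Triangle F (𝓟 A)

/-- The `◊` relation: `F ◊ H` iff whenever `H` meshes `F` there is a countable set
meshing with `F ∨ H` (i.e. `F ⊓ H`). -/
def Diamond {Z : Type u} (F H : Filter Z) : Prop :=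
  Mesh F H → ∃ A : Set Z, A.Countable ∧ Mesh (𝓟 A) (F ⊓ H)

/-- The image filter `AF` of a filter `F` on `X` under a set `A ⊆ X × Y`:
generated by the sets `A(F) = {y | ∃ x ∈ F, (x, y) ∈ A}`. -/
def imgSet {X Y : Type u} (A : Set (X × Y)) (F : Filter X) : Filter Y :=
  ⨅ f ∈ F, 𝓟 {y | ∃ x ∈ f, (x, y) ∈ A}

theorem mem_imgSet {X Y : Type u} {A : Set (X × Y)} {F : Filter X} {S : Set Y} :
    S ∈ imgSet A F ↔ ∃ f ∈ F, {y | ∃ x ∈ f, (x, y) ∈ A} ⊆ S := by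
  have hmono : Monotone fun f : Set X => {y | ∃ x ∈ f, (x, y) ∈ A} :=
    fun f g hfg y ⟨x, hx, hA⟩ => ⟨x, hfg hx, hA⟩
  exact Filter.mem_lift'_sets hmono

/-- An infimum (Mathlib's `⨆`) of countably based filters is Fréchet. -/
theorem frechet_iSup {I Z : Type u} (L : I → Filter Z) (hL : ∀ i, (L i).IsCountablyGenerated) :
    Frechet (⨆ i, L i) := by
  intro A hA
  have hne : ¬ ∀ i, 𝓟 A ⊓ L i = ⊥ := by
    intro h
    apply hA.ne
    rw [inf_comm, ← iSup_inf_principal]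
    simp [inf_comm _ (𝓟 A), h]
  push Not at hne
  obtain ⟨i, hi⟩ := hne
  have := hL i
  exact ⟨𝓟 A ⊓ L i, hi, inferInstance,
    le_inf (inf_le_right.trans (le_iSup L i)) inf_le_left⟩

/-- A set meshing with a Fréchet filter contains a sequence finer than the filter. -/
theorem Frechet.exists_seq {Z : Type u} {H : Filter Z} (hH : Frechet H) {A : Set Z}
    (hA : Mesh (𝓟 A) H) : ∃ y : ℕ → Z, (∀ n, y n ∈ A) ∧ Tendsto y atTop H := by
  obtain ⟨L, hne, hcg, hL⟩ := hH A hA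
  obtain ⟨y, hy⟩ := L.exists_seq_tendsto
  obtain ⟨N, hN⟩ := eventually_atTop.1 (tendsto_principal.1 (hy.mono_right (hL.trans inf_le_right)))
  exact ⟨fun n => y (n + N), fun n => hN _ (Nat.le_add_left N n),
    (hy.mono_right (hL.trans inf_le_left)).comp (tendsto_add_atTop_nat N)⟩

theorem exists_countable_mesh_of_ker {X : Type u} {F : Filter X}
    (hF : ∀ (Y : Type u) (A : Set (X × Y)), ∀ H : Filter Y, Frechet H → Diamond (imgSet A F) H)
    (I : Type u) (x : I → ℕ → X) (hx : Mesh (⨆ i, Filter.map (x i) Filter.atTop) F) :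
    ∃ J : Set I, J.Countable ∧ Mesh (⨆ i ∈ J, Filter.map (x i) Filter.atTop) F := by
  let A : Set (X × (I × ℕ)) := {p | p.1 = x p.2.1 p.2.2}
  let H : Filter (I × ℕ) := ⨆ i, map (fun n : ℕ => (i, n)) atTop
  have hm : Mesh (imgSet A F) H := by
    refine inf_neBot_iff.2 fun {s} hs {h} hh => ?_
    obtain ⟨f, hf, hfs⟩ := mem_imgSet.1 hs
    have hE : {z | ∃ p ∈ h, z = x p.1 p.2} ∈ ⨆ i, map (x i) atTop :=
      mem_iSup.2 fun i => mem_map.2 <| mem_of_superset (mem_map.1 (mem_iSup.1 hh i)) fun n hn => ⟨(i, n), hn, rfl⟩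
    obtain ⟨z, ⟨p, hp, hzp⟩, hzf⟩ := inf_neBot_iff.1 hx hE hf
    exact ⟨p, hfs ⟨z, hzf, hzp⟩, hp⟩
  obtain ⟨B, hB, hBm⟩ := hF _ A H (frechet_iSup _ fun i => inferInstance) hm
  refine ⟨Prod.fst '' B, hB.image _, inf_neBot_iff.2 fun {E} hE {f} hf => ?_⟩
  have hh : {p : I × ℕ | p.1 ∈ Prod.fst '' B → x p.1 p.2 ∈ E} ∈ H := by
    refine mem_iSup.2 fun i => ?_
    by_cases hi : i ∈ Prod.fst '' B
    · exact mem_map.2 <| mem_of_superset (mem_map.1 (mem_iSup.1 (mem_iSup.1 hE i) hi)) fun n hn _ => hn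
    · exact mem_map.2 <| mem_of_superset univ_mem fun n _ hn => absurd hn hi
  obtain ⟨p, hpB, ⟨z, hzf, hz⟩, hph⟩ := inf_neBot_iff.1 hBm (mem_principal_self B)
    (inter_mem_inf (mem_imgSet.2 ⟨f, hf, Subset.rfl⟩) hh)
  have hz' : z = x p.1 p.2 := hz
  exact ⟨z, hz' ▸ hph ⟨p, hpB, rfl⟩, hzf⟩

theorem diamond_imgSet_of_exists_countable_mesh {X : Type u} {F : Filter X}
    (hF : ∀ (I : Type u) (x : I → ℕ → X), Mesh (⨆ i, Filter.map (x i) Filter.atTop) F →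
      ∃ J : Set I, J.Countable ∧ Mesh (⨆ i ∈ J, Filter.map (x i) Filter.atTop) F)
    {Y : Type u} (A : Set (X × Y)) {H : Filter Y} (hH : Frechet H) :
    Diamond (imgSet A F) H := by
  intro hm
  let I : Type u := {s : ℕ → X × Y // (∀ n, s n ∈ A) ∧ Tendsto (fun n => (s n).2) atTop H}
  let x : I → ℕ → X := fun s n => (s.1 n).1
  have hx : Mesh (⨆ i, map (x i) atTop) F := by
    refine inf_neBot_iff.2 fun {E} hE {f} hf => ?_
    have hD : Mesh (𝓟 {y | ∃ z ∈ f, (z, y) ∈ A}) H :=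
      inf_neBot_iff.2 fun {s} hs {h} hh =>
        inf_neBot_iff.1 hm (mem_imgSet.2 ⟨f, hf, mem_principal.1 hs⟩) hh
    obtain ⟨y, hyD, hyH⟩ := hH.exists_seq hD
    choose z hzf hzA using hyD
    have hzE : ∀ᶠ n in atTop, z n ∈ E := mem_iSup.1 hE ⟨fun n => (z n, y n), hzA, hyH⟩
    obtain ⟨n, hn⟩ := hzE.exists
    exact ⟨z n, hn, hzf n⟩
  obtain ⟨J, hJ, hJm⟩ := hF I x hx
  refine ⟨⋃ s ∈ J, range fun n => (s.1 n).2,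
    hJ.biUnion fun s _ => countable_range _, inf_neBot_iff.2 fun {B} hB {t} ht => ?_⟩
  obtain ⟨s, hs, h, hh, rfl⟩ := mem_inf_iff.1 ht
  obtain ⟨f, hf, hfs⟩ := mem_imgSet.1 hs
  have hE : {z | ∃ s ∈ J, ∃ n, z = x s n ∧ (s.1 n).2 ∈ h} ∈ ⨆ i ∈ J, map (x i) atTop :=
    mem_iSup.2 fun s => mem_iSup.2 fun hsJ =>
      mem_map.2 <| mem_of_superset (mem_map.1 (s.2.2 hh)) fun n hn => ⟨s, hsJ, n, rfl, hn⟩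
  obtain ⟨_, ⟨s, hsJ, n, rfl, hn⟩, hzf⟩ := inf_neBot_iff.1 hJm hE hf
  exact ⟨(s.1 n).2, hB (mem_biUnion hsJ ⟨n, rfl⟩), hfs ⟨_, hzf, s.2.1 n⟩, hn⟩

/-- `F ∈ ker(F_1^{△◊})` iff every family of sequences whose tail filters have infimum
(the paper's `⋀`, which is Mathlib's `⨆`) meshing `F` has a countable subfamily whose
tail filters have infimum meshing `F`.  The tail filter of `x : ℕ → X` is
`Filter.map x Filter.atTop`. -/
theorem stmt13 {X : Type u} (F : Filter X) :
    (∀ (Y : Type u) (A : Set (X × Y)), ∀ H : Filter Y, Frechet H → Diamond (imgSet A F) H)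
      ↔ ∀ (I : Type u) (x : I → ℕ → X),
          Mesh (⨆ i, Filter.map (x i) Filter.atTop) F →
          ∃ J : Set I, J.Countable ∧ Mesh (⨆ i ∈ J, Filter.map (x i) Filter.atTop) F := by
  exact ⟨exists_countable_mesh_of_ker,
    fun hF Y A H hH => diamond_imgSet_of_exists_countable_mesh hF A hH⟩
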